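/- Fix a real constant a. Let T = q1⁴(q2−q1/7)p1²/(q1−q2) + q2⁴(q1−q2/7)p2²/(q2−q1), Ṽ = a(3q1−q2)(q1−3q2)/(q1q2√(q1²−6q1q2+q2²)), K̃1 = q1²(3q1³−27q1²q2+33q1q2²−q2³)p1 + q2²(q1³−33q1²q2+27q1q2²−3q2³)p2, K̃2 = (q1²p1−q2²p2)(q1²(q1−3q2)p1+q2²(3q1−q2)p2)/(q1q2(q1−q2)³·K̃1-normalization), i.e. K = K̃1·K̃2, and Ũ2 = 14a(q1+q2)/(q1²q2²(q1−q2)√(q1²−6q1q2+q2²)). Then H1 = T+Ṽ and H2 = K̃1²·(K̃2+Ũ2)² satisfy {H1,H2} = 0 on the open set where q1,q2 ≠ 0, q1 ≠ q2, and q1²−6q1q2+q2² > 0. -/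

import Mathlib

/-- Canonical Poisson bracket of two functions on phase space (q1,q2,p1,p2). -/
noncomputable def pb (f g : ℝ → ℝ → ℝ → ℝ → ℝ) (q1 q2 p1 p2 : ℝ) : ℝ :=
  (deriv (fun x => f x q2 p1 p2) q1) * (deriv (fun x => g q1 q2 x p2) p1)
  - (deriv (fun x => f q1 q2 x p2) p1) * (deriv (fun x => g x q2 p1 p2) q1)
  + (deriv (fun x => f q1 x p1 p2) q2) * (deriv (fun x => g q1 q2 p1 x) p2)
  - (deriv (fun x => f q1 q2 p1 x) p2) * (deriv (fun x => g q1 x p1 p2) q2)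

noncomputable def H1 (a q1 q2 p1 p2 : ℝ) : ℝ :=
  q1^4 * (q2 - q1/7) * p1^2 / (q1 - q2) + q2^4 * (q1 - q2/7) * p2^2 / (q2 - q1)
  + a * (3*q1 - q2) * (q1 - 3*q2) / (q1*q2*Real.sqrt (q1^2 - 6*q1*q2 + q2^2))

noncomputable def H2 (a q1 q2 p1 p2 : ℝ) : ℝ :=
  (q1^2*(3*q1^3 - 27*q1^2*q2 + 33*q1*q2^2 - q2^3)*p1
   + q2^2*(q1^3 - 33*q1^2*q2 + 27*q1*q2^2 - 3*q2^3)*p2)^2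
  * ((q1^2*p1 - q2^2*p2)*(q1^2*(q1 - 3*q2)*p1 + q2^2*(3*q1 - q2)*p2)
       / (q1*q2*(q1 - q2)^3)
     + 14*a*(q1 + q2)/(q1^2*q2^2*(q1 - q2)*Real.sqrt (q1^2 - 6*q1*q2 + q2^2)))^2

/-- The square root of `H2`: the product of a linear and a corrected quadratic form in the momenta. -/
noncomputable def rootH2 (a q1 q2 p1 p2 : ℝ) : ℝ :=
  (q1^2*(3*q1^3 - 27*q1^2*q2 + 33*q1*q2^2 - q2^3)*p1
   + q2^2*(q1^3 - 33*q1^2*q2 + 27*q1*q2^2 - 3*q2^3)*p2)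
  * ((q1^2*p1 - q2^2*p2)*(q1^2*(q1 - 3*q2)*p1 + q2^2*(3*q1 - q2)*p2)
       / (q1*q2*(q1 - q2)^3)
     + 14*a*(q1 + q2)/(q1^2*q2^2*(q1 - q2)*Real.sqrt (q1^2 - 6*q1*q2 + q2^2)))

lemma H2_eq_rootH2_sq (a q1 q2 p1 p2 : ℝ) : H2 a q1 q2 p1 p2 = rootH2 a q1 q2 p1 p2 ^ 2 := by
  rw [H2, rootH2, mul_pow]

lemma H1_swap (a q1 q2 p1 p2 : ℝ) : H1 a q1 q2 p1 p2 = H1 a q2 q1 p2 p1 := by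
  have hD : q2^2 - 6*q2*q1 + q1^2 = q1^2 - 6*q1*q2 + q2^2 := by ring
  rw [H1, H1, hD]
  ring

lemma rootH2_swap (a q1 q2 p1 p2 : ℝ) : rootH2 a q1 q2 p1 p2 = rootH2 a q2 q1 p2 p1 := by
  have hD : q2^2 - 6*q2*q1 + q1^2 = q1^2 - 6*q1*q2 + q2^2 := by ring
  have hd : q2 - q1 = -(q1 - q2) := by ring
  rw [rootH2, rootH2, hD, hd]
  simp only [neg_pow (q1 - q2) 3, div_eq_mul_inv, mul_inv, inv_neg, mul_neg, neg_mul]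
  norm_num
  ring

/-- The derivative of `H1` in `q1`, with `r` standing for the inverse square root. -/
noncomputable def dqH1 (a r q1 q2 p1 p2 : ℝ) : ℝ :=
  p1^2 * ((4*q1^3*q2 - 5*q1^4/7)*(q1 - q2) - q1^4*(q2 - q1/7)) / (q1 - q2)^2
  + p2^2 * q2^5 * (6/7) / (q1 - q2)^2
  + a * r * ((6*q1 - 10*q2)/(q1*q2) - (3*q1 - q2)*(q1 - 3*q2)/(q1^2*q2)
    - (q1 - 3*q2)*((3*q1 - q2)*(q1 - 3*q2))/(q1*q2*(q1^2 - 6*q1*q2 + q2^2)))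

/-- The derivative of `rootH2` in `q1`, with `r` standing for the inverse square root. -/
noncomputable def dqRootH2 (a r q1 q2 p1 p2 : ℝ) : ℝ :=
  ((15*q1^4 - 108*q1^3*q2 + 99*q1^2*q2^2 - 2*q1*q2^3)*p1
    + q2^2*(3*q1^2 - 66*q1*q2 + 27*q2^2)*p2)
  * ((q1^2*p1 - q2^2*p2)*(q1^2*(q1 - 3*q2)*p1 + q2^2*(3*q1 - q2)*p2) / (q1*q2*(q1 - q2)^3)
    + 14*a*r*(q1 + q2)/(q1^2*q2^2*(q1 - q2)))
  + (q1^2*(3*q1^3 - 27*q1^2*q2 + 33*q1*q2^2 - q2^3)*p1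
    + q2^2*(q1^3 - 33*q1^2*q2 + 27*q1*q2^2 - 3*q2^3)*p2)
  * ((2*q1*p1*(q1^2*(q1 - 3*q2)*p1 + q2^2*(3*q1 - q2)*p2)
      + (q1^2*p1 - q2^2*p2)*((3*q1^2 - 6*q1*q2)*p1 + 3*q2^2*p2)) / (q1*q2*(q1 - q2)^3)
    - (q1^2*p1 - q2^2*p2)*(q1^2*(q1 - 3*q2)*p1 + q2^2*(3*q1 - q2)*p2)*(4*q1 - q2)
      / (q1^2*q2*(q1 - q2)^4)
    + 14*a*r*(1/(q1^2*q2^2*(q1 - q2)) - 2*(q1 + q2)/(q1^3*q2^2*(q1 - q2))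
      - (q1 + q2)/(q1^2*q2^2*(q1 - q2)^2)
      - (q1 + q2)*(q1 - 3*q2)/(q1^2*q2^2*(q1 - q2)*(q1^2 - 6*q1*q2 + q2^2))))

/-- The derivative of `rootH2` in `p1`, with `r` standing for the inverse square root. -/
noncomputable def dpRootH2 (a r q1 q2 p1 p2 : ℝ) : ℝ :=
  q1^2*(3*q1^3 - 27*q1^2*q2 + 33*q1*q2^2 - q2^3)
  * ((q1^2*p1 - q2^2*p2)*(q1^2*(q1 - 3*q2)*p1 + q2^2*(3*q1 - q2)*p2) / (q1*q2*(q1 - q2)^3)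
    + 14*a*r*(q1 + q2)/(q1^2*q2^2*(q1 - q2)))
  + (q1^2*(3*q1^3 - 27*q1^2*q2 + 33*q1*q2^2 - q2^3)*p1
    + q2^2*(q1^3 - 33*q1^2*q2 + 27*q1*q2^2 - 3*q2^3)*p2)
  * ((q1^2*(q1^2*(q1 - 3*q2)*p1 + q2^2*(3*q1 - q2)*p2)
      + (q1^2*p1 - q2^2*p2)*(q1^2*(q1 - 3*q2))) / (q1*q2*(q1 - q2)^3))

section Derivatives

variable (a q1 q2 p1 p2 : ℝ)

lemma hasDerivAt_inv_sqrt (h4 : 0 < q1^2 - 6*q1*q2 + q2^2) :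
    HasDerivAt (fun x => (√(x^2 - 6*x*q2 + q2^2))⁻¹)
      (-(q1 - 3*q2) * (√(q1^2 - 6*q1*q2 + q2^2))⁻¹ / (q1^2 - 6*q1*q2 + q2^2)) q1 := by
  have hx := hasDerivAt_id' q1
  have hD := (((hx.pow 2).sub ((hx.const_mul 6).mul_const q2)).add_const (q2^2)).sqrt h4.ne'
  have hs : √(q1^2 - 6*q1*q2 + q2^2) ≠ 0 := (Real.sqrt_pos.2 h4).ne'
  refine (hD.inv hs).congr_deriv ?_
  simp only [Pi.pow_apply, Pi.sub_apply, Real.sq_sqrt h4.le]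
  have := h4.ne'
  field_simp
  norm_num
  ring

lemma hasDerivAt_H1_position (h1 : q1 ≠ 0) (h2 : q2 ≠ 0) (h3 : q1 ≠ q2)
    (h4 : 0 < q1^2 - 6*q1*q2 + q2^2) :
    HasDerivAt (fun x => H1 a x q2 p1 p2)
      (dqH1 a (√(q1^2 - 6*q1*q2 + q2^2))⁻¹ q1 q2 p1 p2) q1 := by
  have hx := hasDerivAt_id' q1
  have hd : q1 - q2 ≠ 0 := sub_ne_zero.2 h3
  have hr := hasDerivAt_inv_sqrt q1 q2 h4
  have hT1 := (((hx.pow 4).mul ((hx.div_const 7).const_sub q2)).mul_const (p1^2)).mul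
    ((hx.sub_const q2).inv hd)
  have hT2 := ((((hx.sub_const (q2/7)).const_mul (q2^4)).mul_const (p2^2))).mul
    (((hx.sub_const q2).inv hd).neg)
  have hV := ((((((hx.const_mul 3).sub_const q2).const_mul a).mul
    (hx.sub_const (3*q2)))).mul ((hx.mul_const q2).inv (mul_ne_zero h1 h2))).mul hr
  refine (((hT1.add hT2).add hV).congr_deriv ?_).congr_of_eventuallyEq
    (Filter.Eventually.of_forall fun x => ?_)
  · have := h4.ne'
    generalize (√(q1^2 - 6*q1*q2 + q2^2))⁻¹ = r
    simp [dqH1]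
    field_simp
    ring
  · have : q2 - x = -(x - q2) := by ring
    simp only [H1, Pi.add_apply, Pi.mul_apply, Pi.pow_apply, Pi.inv_apply, Pi.neg_apply, this,
      div_eq_mul_inv, mul_inv, inv_neg]
    ring

lemma hasDerivAt_H1_momentum :
    HasDerivAt (fun x => H1 a q1 q2 x p2) (2*q1^4*(q2 - q1/7)*p1/(q1 - q2)) p1 := by
  have hx := hasDerivAt_id' p1
  have h := (((((hx.pow 2).const_mul (q1^4 * (q2 - q1/7))).div_const (q1 - q2)).add_const
    (q2^4 * (q1 - q2/7) * p2^2 / (q2 - q1))).add_const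
    (a * (3*q1 - q2) * (q1 - 3*q2) / (q1*q2*√(q1^2 - 6*q1*q2 + q2^2))))
  refine h.congr_deriv ?_
  norm_num
  ring

lemma hasDerivAt_rootH2_position (h1 : q1 ≠ 0) (h2 : q2 ≠ 0) (h3 : q1 ≠ q2)
    (h4 : 0 < q1^2 - 6*q1*q2 + q2^2) :
    HasDerivAt (fun x => rootH2 a x q2 p1 p2)
      (dqRootH2 a (√(q1^2 - 6*q1*q2 + q2^2))⁻¹ q1 q2 p1 p2) q1 := by
  have hx := hasDerivAt_id' q1
  have hd : q1 - q2 ≠ 0 := sub_ne_zero.2 h3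
  have hr := hasDerivAt_inv_sqrt q1 q2 h4
  have hA := (hx.pow 2).mul (((((hx.pow 3).const_mul 3).sub
    (((hx.pow 2).const_mul 27).mul_const q2)).add
    ((hx.const_mul 33).mul_const (q2^2))).sub_const (q2^3))
  have hB := ((((hx.pow 3).sub (((hx.pow 2).const_mul 33).mul_const q2)).add
    ((hx.const_mul 27).mul_const (q2^2))).sub_const (3*q2^3)).const_mul (q2^2)
  have hK := (hA.mul_const p1).add (hB.mul_const p2)
  have hM := ((hx.pow 2).mul_const p1).sub_const (q2^2*p2)
  have hN := (((hx.pow 2).mul (hx.sub_const (3*q2))).mul_const p1).add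
    ((((hx.const_mul 3).sub_const q2).const_mul (q2^2)).mul_const p2)
  have hQ := (hM.mul hN).mul (((hx.mul_const q2).mul ((hx.sub_const q2).pow 3)).inv
    (mul_ne_zero (mul_ne_zero h1 h2) (pow_ne_zero 3 hd)))
  have hU := (((hx.add_const q2).const_mul (14*a)).mul
    ((((hx.pow 2).mul_const (q2^2)).mul (hx.sub_const q2)).inv
      (mul_ne_zero (mul_ne_zero (pow_ne_zero 2 h1) (pow_ne_zero 2 h2)) hd))).mul hr
  refine ((hK.mul (hQ.add hU)).congr_deriv ?_).congr_of_eventuallyEq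
    (Filter.Eventually.of_forall fun x => ?_)
  · have := h4.ne'
    simp only [Pi.add_apply, Pi.sub_apply, Pi.mul_apply, Pi.pow_apply, Pi.inv_apply, dqRootH2]
    generalize (√(q1^2 - 6*q1*q2 + q2^2))⁻¹ = r
    norm_num
    field_simp
    ring
  · simp only [rootH2, Pi.add_apply, Pi.sub_apply, Pi.mul_apply, Pi.pow_apply, Pi.inv_apply,
      div_eq_mul_inv, mul_inv]
    ring

lemma hasDerivAt_rootH2_momentum :
    HasDerivAt (fun x => rootH2 a q1 q2 x p2)
      (dpRootH2 a (√(q1^2 - 6*q1*q2 + q2^2))⁻¹ q1 q2 p1 p2) p1 := by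
  have hx := hasDerivAt_id' p1
  have hK := (hx.const_mul (q1^2*(3*q1^3 - 27*q1^2*q2 + 33*q1*q2^2 - q2^3))).add_const
    (q2^2*(q1^3 - 33*q1^2*q2 + 27*q1*q2^2 - 3*q2^3)*p2)
  have hM := (hx.const_mul (q1^2)).sub_const (q2^2*p2)
  have hN := (hx.const_mul (q1^2*(q1 - 3*q2))).add_const (q2^2*(3*q1 - q2)*p2)
  have hQ := ((hM.mul hN).div_const (q1*q2*(q1 - q2)^3)).add_const
    (14*a*(q1 + q2)/(q1^2*q2^2*(q1 - q2)*√(q1^2 - 6*q1*q2 + q2^2)))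
  refine (hK.mul hQ).congr_deriv ?_
  simp only [Pi.mul_apply, dpRootH2, div_eq_mul_inv, mul_inv]
  ring

end Derivatives

lemma bracket_identity (a r q1 q2 p1 p2 : ℝ) (h1 : q1 ≠ 0) (h2 : q2 ≠ 0) (h3 : q1 ≠ q2)
    (hD : q1^2 - 6*q1*q2 + q2^2 ≠ 0) :
    dqH1 a r q1 q2 p1 p2 * dpRootH2 a r q1 q2 p1 p2
    - 2*q1^4*(q2 - q1/7)*p1/(q1 - q2) * dqRootH2 a r q1 q2 p1 p2
    + dqH1 a r q2 q1 p2 p1 * dpRootH2 a r q2 q1 p2 p1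
    - 2*q2^4*(q1 - q2/7)*p2/(q2 - q1) * dqRootH2 a r q2 q1 p2 p1 = 0 := by
  have hD' : q2^2 - 6*q2*q1 + q1^2 = q1^2 - 6*q1*q2 + q2^2 := by ring
  have hd : q1 - q2 ≠ 0 := sub_ne_zero.2 h3
  have hd' : q2 - q1 = -(q1 - q2) := by ring
  simp only [dqH1, dqRootH2, dpRootH2, hD', hd']
  generalize hE : q1^2 - 6*q1*q2 + q2^2 = E at hD
  field_simp
  rw [← hE]
  ring

theorem stmt16 (a q1 q2 p1 p2 : ℝ) (h1 : q1 ≠ 0) (h2 : q2 ≠ 0) (h3 : q1 ≠ q2)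
    (h4 : 0 < q1^2 - 6*q1*q2 + q2^2) :
    pb (H1 a) (H2 a) q1 q2 p1 p2 = 0 := by
  have hD : q2^2 - 6*q2*q1 + q1^2 = q1^2 - 6*q1*q2 + q2^2 := by ring
  have h4' : 0 < q2^2 - 6*q2*q1 + q1^2 := hD ▸ h4
  have hH1q := (hasDerivAt_H1_position a q1 q2 p1 p2 h1 h2 h3 h4).deriv
  have hH1q' := (hasDerivAt_H1_position a q2 q1 p2 p1 h2 h1 h3.symm h4').deriv
  have hH1p := (hasDerivAt_H1_momentum a q1 q2 p1 p2).deriv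
  have hH1p' := (hasDerivAt_H1_momentum a q2 q1 p2 p1).deriv
  have hFq := ((hasDerivAt_rootH2_position a q1 q2 p1 p2 h1 h2 h3 h4).fun_pow 2).deriv
  have hFq' := ((hasDerivAt_rootH2_position a q2 q1 p2 p1 h2 h1 h3.symm h4').fun_pow 2).deriv
  have hFp := ((hasDerivAt_rootH2_momentum a q1 q2 p1 p2).fun_pow 2).deriv
  have hFp' := ((hasDerivAt_rootH2_momentum a q2 q1 p2 p1).fun_pow 2).deriv
  rw [funext fun x => H1_swap a x q1 p2 p1, hD] at hH1q'
  rw [funext fun x => H1_swap a q2 q1 x p1] at hH1p'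
  rw [funext fun x => congrArg (· ^ 2) (rootH2_swap a x q1 p2 p1), rootH2_swap a q2, hD] at hFq'
  rw [funext fun x => congrArg (· ^ 2) (rootH2_swap a q2 q1 x p1), rootH2_swap a q2, hD] at hFp'
  simp only [pb, H2_eq_rootH2_sq, hH1q, hH1q', hH1p, hH1p', hFq, hFq', hFp, hFp']
  have key := bracket_identity a (√(q1^2 - 6*q1*q2 + q2^2))⁻¹ q1 q2 p1 p2 h1 h2 h3 h4.ne'
  norm_num
  linear_combination (2 * rootH2 a q1 q2 p1 p2) * key
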